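/- Let J be a unital Jordan algebra over a field F of characteristic different from 2 and 3, let d be a derivation with invertible values of J, and let I be an ideal of J with I ⊆ ker d. Then I² = 0, that is, a b = 0 for all a, b in I. -/

import Mathlib

theorem jordan_lin_aux {J : Type*} [NonAssocRing J]
    (hcomm : ∀ x y : J, x * y = y * x)
    (hjordan : ∀ x y : J, ((x * x) * y) * x = (x * x) * (y * x))
    (h2 : ∀ x : J, x + x = 0 → x = 0) (x y w z : J) :
    ((x * y) * z) * w + ((w * y) * z) * x + ((w * x) * z) * y
      = (x * y) * (z * w) + (w * y) * (z * x) + (w * x) * (z * y) := by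
  have e1 := hjordan (x + y + w) z
  have e2 := hjordan (x + y) z
  have e3 := hjordan (x + w) z
  have e4 := hjordan (y + w) z
  have e5 := hjordan x z
  have e6 := hjordan y z
  have e7 := hjordan w z
  simp only [mul_add, add_mul, hcomm y x, hcomm x w, hcomm y w] at e1 e2 e3 e4
  rw [← sub_eq_zero]
  apply h2
  linear_combination (norm := module) e1 - e2 - e3 - e4 + e5 + e6 + e7


/-- From Kaygorodov–Lopatin–Popov: Jordan algebras admitting derivations with invertible values. -/
theorem jordan_der_inv_values_ideal_in_ker_square_zero2 (F : Type*) [Field F] (h2 : (2 : F) ≠ 0) (h3 : (3 : F) ≠ 0)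
    (J : Type*) [NonAssocRing J] [Module F J] [SMulCommClass F J J] [IsScalarTower F J J]
    (hcomm : ∀ x y : J, x * y = y * x)
    (hjordan : ∀ x y : J, ((x * x) * y) * x = (x * x) * (y * x))
    (d : J →ₗ[F] J) (hder : ∀ a b : J, d (a * b) = d a * b + a * d b)
    (hd0 : d ≠ 0)
    (hdinv : ∀ x : J, d x = 0 ∨ ∃ y : J, d x * y = 1 ∧ (d x * d x) * y = d x)
    (I : Submodule F J) (hideal : ∀ x ∈ I, ∀ j : J, j * x ∈ I)
    (hker : ∀ x ∈ I, d x = 0) :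
    ∀ a ∈ I, ∀ b ∈ I, a * b = 0 := by
  have hh : ∀ x : J, x + x = 0 → x = 0 := by
    intro x hx
    have h : (2 : F) • x = 0 := by rw [two_smul]; exact hx
    exact (smul_eq_zero.mp h).resolve_left h2
  have L := jordan_lin_aux hcomm hjordan hh
  have hz : ∀ a ∈ I, ∀ x : J, a * d x = 0 := by
    intro a ha x
    have h1 := hker _ (hideal a ha x)
    rw [hcomm x a, hder, hker a ha, zero_mul, zero_add] at h1
    exact h1
  obtain ⟨x, hx⟩ : ∃ x, d x ≠ 0 := by
    by_contra! h
    exact hd0 (LinearMap.ext h)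
  obtain ⟨v, hv, -⟩ := (hdinv x).resolve_left hx
  have hu : ∀ a ∈ I, a * d x = 0 := fun a ha => hz a ha x
  generalize d x = u at hv hu
  have hI : ∀ a ∈ I, ∀ j : J, a * j ∈ I := fun a ha j => hcomm j a ▸ hideal a ha j
  have hva : ∀ a ∈ I, a * v = 0 := by
    intro a ha
    have h := L a u v v
    have e1 : (v * a) * v * u = 0 := hu _ (hI _ (hideal a ha v) v)
    rw [hu a ha, hcomm v u, hv, e1, hcomm (1 * v) a, hcomm v a] at h
    simp only [zero_mul, zero_add, add_zero, one_mul, hv, hcomm v u, mul_one, hcomm v a] at h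
    simpa using h
  intro a ha b hb
  have h := L a b v u
  rw [hu _ (hI a ha b), hcomm v b, hcomm v a, hva a ha, hva b hb, hv] at h
  simpa using h.symm
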